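/- Let $-\infty\le a<b\le\infty$, let $f:(a,b)\to\mathbb{R}$ be a smooth function with $f>0$, and let $J\subseteq\mathbb{R}$ be a nonempty open interval. Let $M=(a,b)\times J$ carry the Lorentzian metric $g=-d\tau^2+f(\tau)^2dx^2$. A spacelike curve in $M$ is a piecewise smooth curve $\gamma=(\tau,x)$ on a compact interval of positive length, smooth up to the endpoints on each of its finitely many closed pieces, such that $g(\gamma',\gamma')=-(\tau')^2+f(\tau)^2(x')^2>0$ at all times (for both one-sided velocities at a break) and such that at every break $t$ the one-sided velocities lie in the same connected component of the set of spacelike tangent vectors at $\gamma(t)$, that is, $g(\gamma'(t^-),\gamma'(t^+))>0$. Two points of $M$ are spacelike related if some spacelike curve joins them. Let $z=(\tau_0,x_0)$ and $z'=(\tau_0',x_0')$ be points of $M$ with $\tau_0\le\tau_0'$. Then $z$ and $z'$ are spacelike related if and only if $$\int_{\tau_0}^{\tau_0'} f(\tau)^{-1}\,d\tau<|x_0'-x_0|.$$ -/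

import Mathlib

open Set
open scoped ContDiff

noncomputable section

namespace GRW

/-- The open interval `(a,b)`, with extended-real endpoints, as a subset of `ℝ`. -/
def II (aE bE : EReal) : Set ℝ := {τ : ℝ | aE < (τ : EReal) ∧ (τ : EReal) < bE}

/-- The metric `g^f = -dτ² + f(τ)² dx²` at a point `p = (τ, x)`, applied to the tangent vectors
`v` and `w`. -/
def metric (f : ℝ → ℝ) (p v w : ℝ × ℝ) : ℝ := -(v.1 * w.1) + f p.1 ^ 2 * (v.2 * w.2)

/-- The velocity at the time `t` of the curve `γ` restricted to `[r, r']`; at `t = r` and at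
`t = r'` it is the one-sided derivative. -/
def velocityOn (γ : ℝ → ℝ × ℝ) (r r' t : ℝ) : ℝ × ℝ := derivWithin γ (Icc r r') t

/-- `γ`, restricted to `[s 0, s (n + 1)]`, is a piecewise smooth spacelike curve in `(a,b) × J`
with breaks at most at `s 1 < ⋯ < s n`. It is smooth up to the ends on each of the `n + 1` closed
pieces (hence continuous), all its velocities, the one-sided ones included, are spacelike, and at
each break the velocities from the left and from the right lie in the same component of the set of
spacelike vectors: for two spacelike vectors `v`, `w` this means `g(v, w) > 0`. The last clause is
the usual convention for piecewise smooth timelike curves, applied to the Lorentzian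
metric `-g^f`. -/
structure IsSpacelikeCurve (aE bE : EReal) (f : ℝ → ℝ) (J : Set ℝ)
    (n : ℕ) (s : ℕ → ℝ) (γ : ℝ → ℝ × ℝ) : Prop where
  lt_succ : ∀ i ≤ n, s i < s (i + 1)
  mem : ∀ t ∈ Icc (s 0) (s (n + 1)), (γ t).1 ∈ II aE bE ∧ (γ t).2 ∈ J
  smooth : ∀ i ≤ n, ContDiffOn ℝ ∞ γ (Icc (s i) (s (i + 1)))
  spacelike : ∀ i ≤ n, ∀ t ∈ Icc (s i) (s (i + 1)),
    0 < metric f (γ t) (velocityOn γ (s i) (s (i + 1)) t) (velocityOn γ (s i) (s (i + 1)) t)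
  corner : ∀ i < n,
    0 < metric f (γ (s (i + 1))) (velocityOn γ (s i) (s (i + 1)) (s (i + 1)))
      (velocityOn γ (s (i + 1)) (s (i + 2)) (s (i + 1)))

/-- Two points are spacelike related if a piecewise smooth spacelike curve in `(a,b) × J`
joins them. -/
def SpacelikeRel (aE bE : EReal) (f : ℝ → ℝ) (J : Set ℝ) (z z' : ℝ × ℝ) : Prop :=
  ∃ (n : ℕ) (s : ℕ → ℝ) (γ : ℝ → ℝ × ℝ),
    IsSpacelikeCurve aE bE f J n s γ ∧ γ (s 0) = z ∧ γ (s (n + 1)) = z'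

end GRW

end

open MeasureTheory

namespace GRW

theorem isOpen_II (aE bE : EReal) : IsOpen (II aE bE) :=
  (isOpen_Ioo (a := aE) (b := bE)).preimage continuous_coe_real_ereal

theorem ordConnected_II (aE bE : EReal) : (II aE bE).OrdConnected :=
  ⟨fun _ hx _ hy _ hz => ⟨hx.1.trans_le (EReal.coe_le_coe_iff.2 hz.1),
    (EReal.coe_le_coe_iff.2 hz.2).trans_lt hy.2⟩⟩

section ConformalTime

variable {I : Set ℝ} {f : ℝ → ℝ}

/-- On an open interval where `f` is positive and continuous, `τ ↦ ∫_{τ₀}^τ f⁻¹` is an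
antiderivative of `f⁻¹`. -/
theorem hasDerivAt_integral_inv (hI : IsOpen I) (hIc : I.OrdConnected) (hf : ContinuousOn f I)
    (hpos : ∀ τ ∈ I, 0 < f τ) {τ₀ τ : ℝ} (h₀ : τ₀ ∈ I) (h : τ ∈ I) :
    HasDerivAt (fun u => ∫ r in τ₀..u, (f r)⁻¹) (f τ)⁻¹ τ := by
  have hc : ContinuousOn (fun r => (f r)⁻¹) I := hf.inv₀ fun r hr => (hpos r hr).ne'
  exact intervalIntegral.integral_hasDerivAt_right
    ((hc.mono (hIc.uIcc_subset h₀ h)).intervalIntegrable)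
    (hc.stronglyMeasurableAtFilter hI τ h) (hc.continuousAt (hI.mem_nhds h))

theorem contDiffOn_integral_inv (hI : IsOpen I) (hIc : I.OrdConnected) (hf : ContDiffOn ℝ ∞ f I)
    (hpos : ∀ τ ∈ I, 0 < f τ) {τ₀ : ℝ} (h₀ : τ₀ ∈ I) :
    ContDiffOn ℝ ∞ (fun u => ∫ r in τ₀..u, (f r)⁻¹) I := by
  have hd := fun τ (h : τ ∈ I) => hasDerivAt_integral_inv hI hIc hf.continuousOn hpos h₀ h
  rw [contDiffOn_infty_iff_deriv_of_isOpen hI]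
  exact ⟨fun τ h => (hd τ h).differentiableAt.differentiableWithinAt,
    (hf.inv fun τ h => (hpos τ h).ne').congr fun τ h => (hd τ h).deriv⟩

end ConformalTime

/-- Two spacelike vectors with positive scalar product have `x`-components of the same sign. -/
theorem snd_mul_snd_pos_of_metric_pos {f : ℝ → ℝ} {p v w : ℝ × ℝ} (hv : 0 < metric f p v v)
    (hw : 0 < metric f p w w) (hvw : 0 < metric f p v w) : 0 < v.2 * w.2 := by
  unfold metric at hv hw hvw
  by_contra! hneg
  have h1 : v.1 ^ 2 < (f p.1 * v.2) ^ 2 := by nlinarith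
  have h2 : w.1 ^ 2 < (f p.1 * w.2) ^ 2 := by nlinarith
  have h3 : v.1 ^ 2 * w.1 ^ 2 ≤ (f p.1 * v.2) ^ 2 * (f p.1 * w.2) ^ 2 := by gcongr
  have h4 : 0 ≤ -(f p.1 ^ 2 * (v.2 * w.2)) := by nlinarith [sq_nonneg (f p.1)]
  nlinarith

/-- If `σ = ±1` and `v` is spacelike with `σ * v.2` positive, then `v.1` is less than `f` times
`σ * v.2`. -/
theorem fst_lt_mul_snd_of_metric_pos {f : ℝ → ℝ} {p v : ℝ × ℝ} (hf : 0 < f p.1)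
    {σ : ℝ} (hσ : σ ^ 2 = 1) (hv : 0 < metric f p v v) (hx : 0 < σ * v.2) :
    v.1 < f p.1 * (σ * v.2) := by
  have h : v.1 ^ 2 < (f p.1 * (σ * v.2)) ^ 2 := by
    unfold metric at hv
    have : (f p.1 * (σ * v.2)) ^ 2 = f p.1 ^ 2 * v.2 ^ 2 := by
      rw [mul_pow, mul_pow, hσ, one_mul]
    nlinarith
  exact lt_of_pow_lt_pow_left₀ 2 (by positivity) h

theorem snd_ne_zero_of_metric_pos {f : ℝ → ℝ} {p v : ℝ × ℝ} (hv : 0 < metric f p v v) :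
    v.2 ≠ 0 := by
  intro h
  unfold metric at hv
  rw [h] at hv
  nlinarith [sq_nonneg v.1]

namespace IsSpacelikeCurve

variable {aE bE : EReal} {f : ℝ → ℝ} {J : Set ℝ} {n : ℕ} {s : ℕ → ℝ} {γ : ℝ → ℝ × ℝ}

theorem le_of_le (h : IsSpacelikeCurve aE bE f J n s γ) {i j : ℕ} (hij : i ≤ j) (hj : j ≤ n + 1) :
    s i ≤ s j := by
  induction j, hij using Nat.le_induction with
  | base => rfl
  | succ k _ ih => exact (ih (by omega)).trans (h.lt_succ k (by omega)).le

theorem fst_mem (h : IsSpacelikeCurve aE bE f J n s γ) {i : ℕ} (hi : i ≤ n) {t : ℝ}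
    (ht : t ∈ Icc (s i) (s (i + 1))) : (γ t).1 ∈ II aE bE :=
  (h.mem t ⟨(h.le_of_le (Nat.zero_le i) (by omega)).trans ht.1,
    ht.2.trans (h.le_of_le (by omega) le_rfl)⟩).1

/-- The sign of `x'` is constant along each smooth piece. -/
theorem velocityOn_snd_pos (h : IsSpacelikeCurve aE bE f J n s γ) {i : ℕ} (hi : i ≤ n) {σ : ℝ}
    (hσ : σ ≠ 0) {t₀ t : ℝ} (ht₀ : t₀ ∈ Icc (s i) (s (i + 1))) (ht : t ∈ Icc (s i) (s (i + 1)))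
    (h₀ : 0 < σ * (velocityOn γ (s i) (s (i + 1)) t₀).2) :
    0 < σ * (velocityOn γ (s i) (s (i + 1)) t).2 := by
  have hc : ContinuousOn (fun t => σ * (velocityOn γ (s i) (s (i + 1)) t).2)
      (Icc (s i) (s (i + 1))) :=
    ((h.smooth i hi).continuousOn_derivWithin (uniqueDiffOn_Icc (h.lt_succ i hi))
      (by simp)).snd.const_smul σ
  by_contra! hneg
  obtain ⟨u, hu, hu0⟩ := isPreconnected_Icc.intermediate_value ht ht₀ hc ⟨hneg, h₀.le⟩
  exact mul_ne_zero hσ (snd_ne_zero_of_metric_pos (h.spacelike i hi u hu)) hu0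

/-- The sign of `x'` is constant along a spacelike curve. -/
theorem velocityOn_snd_pos_of_zero (h : IsSpacelikeCurve aE bE f J n s γ) {σ : ℝ} (hσ : σ ≠ 0)
    (h₀ : 0 < σ * (velocityOn γ (s 0) (s 1) (s 0)).2) {i : ℕ} (hi : i ≤ n) {t : ℝ}
    (ht : t ∈ Icc (s i) (s (i + 1))) : 0 < σ * (velocityOn γ (s i) (s (i + 1)) t).2 := by
  induction i generalizing t with
  | zero => exact h.velocityOn_snd_pos hi hσ (left_mem_Icc.2 (h.lt_succ 0 hi).le) ht h₀
  | succ k ih =>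
    have hr := right_mem_Icc.2 (h.lt_succ k (by omega)).le
    have hl := left_mem_Icc.2 (h.lt_succ (k + 1) hi).le
    refine h.velocityOn_snd_pos hi hσ hl ht ?_
    have h1 := ih (by omega) hr
    have h2 := snd_mul_snd_pos_of_metric_pos (h.spacelike k (by omega) _ hr)
      (h.spacelike (k + 1) hi _ hl) (h.corner k (by omega))
    have h3 := mul_pos h1 h2
    have h4 : 0 < (velocityOn γ (s k) (s (k + 1)) (s (k + 1))).2 ^ 2 :=
      sq_pos_of_ne_zero (right_ne_zero_of_mul h1.ne')
    refine pos_of_mul_pos_right (a := (velocityOn γ (s k) (s (k + 1)) (s (k + 1))).2 ^ 2) ?_ h4.le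
    convert h3 using 1
    ring

/-- The signed `x`-coordinate minus the conformal time increases along each smooth piece. -/
theorem piece_lt (h : IsSpacelikeCurve aE bE f J n s γ) (hf : ContDiffOn ℝ ∞ f (II aE bE))
    (hfpos : ∀ τ ∈ II aE bE, 0 < f τ) {σ : ℝ} (hσ : σ ^ 2 = 1) {τ₀ : ℝ} (hτ₀ : τ₀ ∈ II aE bE)
    {i : ℕ} (hi : i ≤ n)
    (hpos : ∀ t ∈ Icc (s i) (s (i + 1)), 0 < σ * (velocityOn γ (s i) (s (i + 1)) t).2) :
    σ * (γ (s i)).2 - (∫ r in τ₀..(γ (s i)).1, (f r)⁻¹) <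
      σ * (γ (s (i + 1))).2 - ∫ r in τ₀..(γ (s (i + 1))).1, (f r)⁻¹ := by
  have hlt := h.lt_succ i hi
  have hd : ∀ t ∈ Icc (s i) (s (i + 1)), HasDerivWithinAt
      (fun t => σ * (γ t).2 - ∫ r in τ₀..(γ t).1, (f r)⁻¹)
      (σ * (velocityOn γ (s i) (s (i + 1)) t).2 -
        (f (γ t).1)⁻¹ * (velocityOn γ (s i) (s (i + 1)) t).1) (Icc (s i) (s (i + 1))) t := by
    intro t ht
    have hγ : HasDerivWithinAt γ (velocityOn γ (s i) (s (i + 1)) t) (Icc (s i) (s (i + 1))) t :=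
      ((h.smooth i hi).differentiableOn (by simp) t ht).hasDerivWithinAt
    have h1 : HasDerivWithinAt (fun t => (γ t).1) (velocityOn γ (s i) (s (i + 1)) t).1
      (Icc (s i) (s (i + 1))) t := hγ.fst
    have h2 : HasDerivWithinAt (fun t => (γ t).2) (velocityOn γ (s i) (s (i + 1)) t).2
      (Icc (s i) (s (i + 1))) t := hγ.snd
    have h3 := (hasDerivAt_integral_inv (isOpen_II aE bE) (ordConnected_II aE bE)
      hf.continuousOn hfpos hτ₀ (h.fst_mem hi ht)).comp_hasDerivWithinAt t h1
    exact (h2.const_mul σ).sub h3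
  refine strictMonoOn_of_deriv_pos (convex_Icc _ _) (fun t ht => (hd t ht).continuousWithinAt) ?_
    (left_mem_Icc.2 hlt.le) (right_mem_Icc.2 hlt.le) hlt
  intro t ht
  rw [interior_Icc] at ht
  have ht' := Ioo_subset_Icc_self ht
  rw [((hd t ht').hasDerivAt (Icc_mem_nhds ht.1 ht.2)).deriv, sub_pos]
  have hfp := hfpos _ (h.fst_mem hi ht')
  rw [inv_mul_lt_iff₀ hfp]
  exact fst_lt_mul_snd_of_metric_pos hfp hσ (h.spacelike i hi t ht') (hpos t ht')

theorem integral_lt_abs (h : IsSpacelikeCurve aE bE f J n s γ) (hf : ContDiffOn ℝ ∞ f (II aE bE))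
    (hfpos : ∀ τ ∈ II aE bE, 0 < f τ) :
    (∫ r in (γ (s 0)).1..(γ (s (n + 1))).1, (f r)⁻¹) < |(γ (s (n + 1))).2 - (γ (s 0)).2| := by
  have hl := left_mem_Icc.2 (h.lt_succ 0 (Nat.zero_le n)).le
  have hne := snd_ne_zero_of_metric_pos (h.spacelike 0 (Nat.zero_le n) _ hl)
  obtain ⟨σ, hσ, h₀⟩ : ∃ σ : ℝ, (σ = 1 ∨ σ = -1) ∧
      0 < σ * (velocityOn γ (s 0) (s (0 + 1)) (s 0)).2 := by
    rcases hne.lt_or_gt with hlt | hgt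
    · exact ⟨-1, .inr rfl, by linarith⟩
    · exact ⟨1, .inl rfl, by linarith⟩
  have hσ2 : σ ^ 2 = 1 := sq_eq_one_iff.2 hσ
  have hmem := h.fst_mem (Nat.zero_le n) hl
  have key : ∀ i ≤ n, σ * (γ (s 0)).2 - (∫ r in (γ (s 0)).1..(γ (s 0)).1, (f r)⁻¹) <
      σ * (γ (s (i + 1))).2 - ∫ r in (γ (s 0)).1..(γ (s (i + 1))).1, (f r)⁻¹ := by
    have step := fun i (hi : i ≤ n) => h.piece_lt hf hfpos hσ2 hmem hi fun t ht =>
      h.velocityOn_snd_pos_of_zero (by rintro rfl; norm_num at hσ2) h₀ hi ht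
    intro i
    induction i with
    | zero => exact step 0
    | succ k ih => exact fun hi => (ih (by omega)).trans (step (k + 1) hi)
  have hn := key n le_rfl
  rw [intervalIntegral.integral_same] at hn
  rcases hσ with rfl | rfl
  · exact lt_of_lt_of_le (by linarith) (le_abs_self _)
  · exact lt_of_lt_of_le (by linarith) (neg_le_abs _)

end IsSpacelikeCurve

/-- A curve along which `τ` is affine and `x` is a signed conformal time plus an affine function
of slope `σ * c`. -/
theorem isSpacelikeCurve_integral_add {aE bE : EReal} {f : ℝ → ℝ} {J : Set ℝ}
    (hf : ContDiffOn ℝ ∞ f (II aE bE)) (hfpos : ∀ τ ∈ II aE bE, 0 < f τ) (hJ : J.OrdConnected)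
    {τ₀ τ₁ x₀ σ c : ℝ} (hτ₀ : τ₀ ∈ II aE bE) (hτ₁ : τ₁ ∈ II aE bE) (hle : τ₀ ≤ τ₁)
    (hσ : σ ^ 2 = 1) (hc : 0 < c) (hx₀ : x₀ ∈ J)
    (hx₁ : x₀ + σ * ((∫ r in τ₀..τ₁, (f r)⁻¹) + c) ∈ J) :
    IsSpacelikeCurve aE bE f J 0 (fun i => i) fun t =>
      (τ₀ + t * (τ₁ - τ₀), x₀ + σ * ((∫ r in τ₀..(τ₀ + t * (τ₁ - τ₀)), (f r)⁻¹) + t * c)) := by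
  have hI := ordConnected_II aE bE
  have hτ : ∀ t ∈ Icc (0 : ℝ) 1, τ₀ + t * (τ₁ - τ₀) ∈ Icc τ₀ τ₁ := fun t ht =>
    ⟨by nlinarith [ht.1], by nlinarith [ht.2]⟩
  have hτI : ∀ t ∈ Icc (0 : ℝ) 1, τ₀ + t * (τ₁ - τ₀) ∈ II aE bE := fun t ht =>
    hI.out hτ₀ hτ₁ (hτ t ht)
  have hd : ∀ t ∈ Icc (0 : ℝ) 1, HasDerivAt (fun t =>
      (τ₀ + t * (τ₁ - τ₀), x₀ + σ * ((∫ r in τ₀..(τ₀ + t * (τ₁ - τ₀)), (f r)⁻¹) + t * c)))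
      (τ₁ - τ₀, σ * ((f (τ₀ + t * (τ₁ - τ₀)))⁻¹ * (τ₁ - τ₀) + c)) t := by
    intro t ht
    have h1 : HasDerivAt (fun t : ℝ => τ₀ + t * (τ₁ - τ₀)) (τ₁ - τ₀) t := by
      simpa using ((hasDerivAt_id t).mul_const (τ₁ - τ₀)).const_add τ₀
    have h2 : HasDerivAt (fun t : ℝ => t * c) c t := by
      simpa using (hasDerivAt_id t).mul_const c
    have h3 := (hasDerivAt_integral_inv (isOpen_II aE bE) hI hf.continuousOn hfpos hτ₀
      (hτI t ht)).comp t h1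
    exact h1.prodMk (((h3.add h2).const_mul σ).const_add x₀)
  have hint : ∀ u ∈ Icc τ₀ τ₁, ∀ v ∈ Icc τ₀ τ₁, IntervalIntegrable (fun r => (f r)⁻¹) volume u v :=
    fun u hu v hv => ((hf.continuousOn.inv₀ fun r hr => (hfpos r hr).ne').mono
      (hI.uIcc_subset (hI.out hτ₀ hτ₁ hu) (hI.out hτ₀ hτ₁ hv))).intervalIntegrable
  have hnn : ∀ u v, u ∈ Icc τ₀ τ₁ → v ∈ Icc τ₀ τ₁ → u ≤ v → 0 ≤ ∫ r in u..v, (f r)⁻¹ :=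
    fun u v hu hv huv => intervalIntegral.integral_nonneg huv fun r hr =>
      (inv_pos.2 (hfpos r (hI.out hτ₀ hτ₁ ⟨hu.1.trans hr.1, hr.2.trans hv.2⟩))).le
  constructor
  · simp
  · intro t ht
    simp only [Nat.cast_zero, zero_add, Nat.cast_one] at ht
    refine ⟨hτI t ht, ?_⟩
    have hm := hτ t ht
    have hl := left_mem_Icc.2 hle
    have hr := right_mem_Icc.2 hle
    have hA := hnn _ _ hl hm hm.1
    have hB := hnn _ _ hm hr hm.2
    have hsum := intervalIntegral.integral_add_adjacent_intervals (hint _ hl _ hm) (hint _ hm _ hr)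
    have ht0 := mul_nonneg ht.1 hc.le
    have ht1 : t * c ≤ c := mul_le_of_le_one_left hc.le ht.2
    rw [← hsum] at hx₁
    rcases sq_eq_one_iff.1 hσ with rfl | rfl
    · exact hJ.out hx₀ hx₁ ⟨by linarith, by linarith⟩
    · exact hJ.out hx₁ hx₀ ⟨by linarith, by linarith⟩
  · intro i hi
    obtain rfl : i = 0 := by omega
    simp only [Nat.cast_zero, zero_add, Nat.cast_one]
    have hτs : ContDiff ℝ ∞ fun t : ℝ => τ₀ + t * (τ₁ - τ₀) := by fun_prop
    have hF := (contDiffOn_integral_inv (isOpen_II aE bE) hI hf hfpos hτ₀).comp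
      (hτs.contDiffOn (s := Icc 0 1)) hτI
    have hcs : ContDiff ℝ ∞ fun t : ℝ => t * c := by fun_prop
    exact hτs.contDiffOn.prodMk
      (contDiffOn_const.add (contDiffOn_const.mul (hF.add hcs.contDiffOn)))
  · intro i hi t ht
    obtain rfl : i = 0 := by omega
    simp only [Nat.cast_zero, zero_add, Nat.cast_one] at ht ⊢
    have hv := (hd t ht).hasDerivWithinAt.derivWithin (uniqueDiffOn_Icc zero_lt_one t ht)
    have hp := hfpos _ (hτI t ht)
    rw [velocityOn, hv, metric]
    set φ := f (τ₀ + t * (τ₁ - τ₀))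
    have hφ : φ * (φ⁻¹ * (τ₁ - τ₀) + c) = (τ₁ - τ₀) + φ * c := by field_simp
    have hexp : φ ^ 2 * (σ * (φ⁻¹ * (τ₁ - τ₀) + c) * (σ * (φ⁻¹ * (τ₁ - τ₀) + c))) =
        ((τ₁ - τ₀) + φ * c) ^ 2 := by
      rw [← hφ]
      linear_combination (φ * (φ⁻¹ * (τ₁ - τ₀) + c)) ^ 2 * hσ
    change 0 < -((τ₁ - τ₀) * (τ₁ - τ₀)) +
      φ ^ 2 * (σ * (φ⁻¹ * (τ₁ - τ₀) + c) * (σ * (φ⁻¹ * (τ₁ - τ₀) + c)))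
    rw [hexp]
    nlinarith [mul_pos hp hc, mul_nonneg (sub_nonneg.2 hle) (mul_pos hp hc).le]
  · intro i hi
    omega

end GRW

/-- In the two-dimensional GRW spacetime `(a,b) × J` with metric `-dτ² + f(τ)² dx²`, two points
`(τ0, x0)`, `(τ0', x0')` with `τ0 ≤ τ0'` are spacelike related if and only if
`∫_{τ0}^{τ0'} f⁻¹ < |x0' - x0|`. -/
theorem spacelike_related_iff
    (aE bE : EReal) (hab : aE < bE) (f : ℝ → ℝ)
    (hf : ContDiffOn ℝ ∞ f (GRW.II aE bE)) (hfpos : ∀ τ ∈ GRW.II aE bE, 0 < f τ)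
    (J : Set ℝ) (hJne : J.Nonempty) (hJopen : IsOpen J) (hJint : J.OrdConnected)
    (τ0 x0 τ0' x0' : ℝ) (hτ0 : τ0 ∈ GRW.II aE bE) (hτ0' : τ0' ∈ GRW.II aE bE)
    (hx0 : x0 ∈ J) (hx0' : x0' ∈ J) (hle : τ0 ≤ τ0') :
    GRW.SpacelikeRel aE bE f J (τ0, x0) (τ0', x0') ↔
      (∫ τ in τ0..τ0', (f τ)⁻¹) < |x0' - x0| := by
  constructor
  · rintro ⟨n, s, γ, h, h0, h1⟩
    simpa [h0, h1] using h.integral_lt_abs hf hfpos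
  · intro hlt
    obtain ⟨σ, hσ, hx⟩ : ∃ σ : ℝ, σ ^ 2 = 1 ∧ x0' = x0 + σ * |x0' - x0| := by
      rcases abs_choice (x0' - x0) with h | h
      · exact ⟨1, by norm_num, by rw [h]; ring⟩
      · exact ⟨-1, by norm_num, by rw [h]; ring⟩
    have hend : x0 + σ * ((∫ r in τ0..τ0', (f r)⁻¹) +
        (|x0' - x0| - ∫ r in τ0..τ0', (f r)⁻¹)) = x0' := by
      rw [add_sub_cancel, ← hx]
    refine ⟨0, fun i => i, _, GRW.isSpacelikeCurve_integral_add hf hfpos hJint hτ0 hτ0' hle hσ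
      (sub_pos.2 hlt) hx0 (hend.symm ▸ hx0'), by simp, ?_⟩
    simpa using hend
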